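/- For non-negative integers s_1, s_2, t, let M(s_1, s_2, t) be the graph on 2 + s_1 + s_2 + 2t vertices constructed as follows: start from the disjoint union of t copies of K_2 (with edges a_i b_i) and s_1 + s_2 isolated vertices; add two adjacent vertices x and y, where x is adjacent to a_1,…,a_t and to s_1 of the isolated vertices, and y is adjacent to all remaining vertices, namely b_1,…,b_t and the other s_2 isolated vertices. Then the Seidel matrix of the disjoint union M(s_1,s_2,t) ∪ 2K_2 has smallest eigenvalue at least −5 if and only if 3s_1 + 3s_2 + 4t ≤ 36. -/

import Mathlib

open Matrix

/-- A Seidel matrix: symmetric, zero diagonal, off-diagonal entries `±1`. -/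
def IsSeidel {n : ℕ} (S : Matrix (Fin n) (Fin n) ℝ) : Prop :=
  S.IsSymm ∧ (∀ i, S i i = 0) ∧ ∀ i j, i ≠ j → S i j = 1 ∨ S i j = -1

/-- Smallest eigenvalue of a real symmetric matrix (junk value `0` if not Hermitian). -/
noncomputable def minEig {m : Type*} [Fintype m] [DecidableEq m] (A : Matrix m m ℝ) : ℝ := by
  classical
  exact if hA : A.IsHermitian then ⨅ i, hA.eigenvalues i else 0

/-- Largest eigenvalue of a real symmetric matrix (junk value `0` if not Hermitian). -/
noncomputable def maxEig {m : Type*} [Fintype m] [DecidableEq m] (A : Matrix m m ℝ) : ℝ := by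
  classical
  exact if hA : A.IsHermitian then ⨆ i, hA.eigenvalues i else 0

/-- The Seidel matrix of a simple graph `G`, i.e. `J - I - 2A(G)`:
zero diagonal, `-1` on adjacent pairs, `1` on distinct non-adjacent pairs. -/
noncomputable def seidelOf {V : Type*} [Fintype V] (G : SimpleGraph V) : Matrix V V ℝ := by
  classical
  exact Matrix.of fun i j => if i = j then 0 else if G.Adj i j then -1 else 1

/-- Smallest eigenvalue of the Seidel matrix of a finite graph. -/
noncomputable def minSeidelEig {V : Type*} [Finite V] (G : SimpleGraph V) : ℝ := by
  classical
  letI := Fintype.ofFinite V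
  exact minEig (seidelOf G)

/-- Spectral radius (largest adjacency eigenvalue) of a finite graph. -/
noncomputable def specRad {V : Type*} [Finite V] (G : SimpleGraph V) : ℝ := by
  classical
  letI := Fintype.ofFinite V
  exact maxEig (G.adjMatrix ℝ)

/-- Switching equivalence: `T = D S D` for some diagonal `±1` matrix `D`. -/
def SwEquiv {n : ℕ} (S T : Matrix (Fin n) (Fin n) ℝ) : Prop :=
  ∃ ε : Fin n → ℝ, (∀ i, ε i = 1 ∨ ε i = -1) ∧
    T = Matrix.diagonal ε * S * Matrix.diagonal ε

/-- The switching graph of a Seidel matrix `S`: the graph on `2n` vertices whose Seidel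
matrix is the block matrix `((S, I - S), (I - S, S))`, adjacency given by entries `-1`. -/
def switchGraph {n : ℕ} (S : Matrix (Fin n) (Fin n) ℝ) : SimpleGraph (Fin n ⊕ Fin n) :=
  SimpleGraph.fromRel fun x y => Matrix.fromBlocks S (1 - S) (1 - S) S x y = -1

/-- Independence number of a graph. -/
noncomputable def indepNum {V : Type*} (G : SimpleGraph V) : ℕ := Gᶜ.cliqueNum

/-- The graph consisting of `t` disjoint copies of `K₂`. -/
def nK2 (t : ℕ) : SimpleGraph (Fin t × Fin 2) :=
  SimpleGraph.fromRel fun p q => p.1 = q.1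

/-- The graph `M(s₁, s₂, t)`: the disjoint union of `t` copies of `K₂` (edges `aₖbₖ`) and
`s₁ + s₂` isolated vertices, together with two new adjacent vertices `x`, `y`, where `x` is
adjacent to `a₁, …, a_t` and the `s₁` isolated vertices, and `y` is adjacent to all remaining
vertices, namely `b₁, …, b_t` and the other `s₂` isolated vertices. -/
def Mgraph (s₁ s₂ t : ℕ) :
    SimpleGraph ((Unit ⊕ Unit) ⊕ ((Fin t × Fin 2) ⊕ (Fin s₁ ⊕ Fin s₂))) :=
  SimpleGraph.fromRel fun p q =>
    (p = Sum.inl (Sum.inl ()) ∧ q = Sum.inl (Sum.inr ())) ∨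
    (∃ k : Fin t, p = Sum.inl (Sum.inl ()) ∧ q = Sum.inr (Sum.inl (k, 0))) ∨
    (∃ i : Fin s₁, p = Sum.inl (Sum.inl ()) ∧ q = Sum.inr (Sum.inr (Sum.inl i))) ∨
    (∃ k : Fin t, p = Sum.inl (Sum.inr ()) ∧ q = Sum.inr (Sum.inl (k, 1))) ∨
    (∃ j : Fin s₂, p = Sum.inl (Sum.inr ()) ∧ q = Sum.inr (Sum.inr (Sum.inr j))) ∨
    (∃ k : Fin t, p = Sum.inr (Sum.inl (k, 0)) ∧ q = Sum.inr (Sum.inl (k, 1)))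


open scoped Pointwise in
lemma minEig_iff {m : Type*} [Fintype m] [DecidableEq m] [Nonempty m] (A : Matrix m m ℝ)
    (hA : A.IsHermitian) : -5 ≤ minEig A ↔ ∀ v : m → ℝ, 0 ≤ v ⬝ᵥ (A *ᵥ v) + 5 * (v ⬝ᵥ v) := by
  have hB : (A + (5:ℝ) • (1 : Matrix m m ℝ)).IsHermitian := by
    apply hA.add
    simp [Matrix.IsHermitian]
  have h1 : -5 ≤ minEig A ↔ ∀ i, -5 ≤ hA.eigenvalues i := by
    unfold minEig
    rw [dif_pos hA]
    have hb : BddBelow (Set.range hA.eigenvalues) := (Set.finite_range _).bddBelow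
    convert le_ciInf_iff hb using 1
  have h2 : (A + (5:ℝ) • (1 : Matrix m m ℝ)).PosSemidef ↔ ∀ i, -5 ≤ hA.eigenvalues i := by
    rw [Matrix.posSemidef_iff_isHermitian_and_spectrum_nonneg]
    have : spectrum ℝ (A + (5:ℝ) • (1 : Matrix m m ℝ)) = Set.range hA.eigenvalues + ({5} : Set ℝ) := by
      rw [← hA.spectrum_real_eq_range_eigenvalues, spectrum.add_singleton_eq]
      simp [Algebra.algebraMap_eq_smul_one]
    rw [this]
    constructor
    · rintro ⟨-, h⟩ i
      have := h (Set.add_mem_add ⟨i, rfl⟩ rfl)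
      simp at this
      linarith
    · intro h
      refine ⟨hB, ?_⟩
      rintro _ ⟨_, ⟨i, rfl⟩, _, rfl, rfl⟩
      have := h i
      simp
      linarith
  rw [h1, ← h2, Matrix.posSemidef_iff_dotProduct_mulVec, and_iff_right hB]
  simp [Matrix.add_mulVec, Matrix.smul_mulVec, dotProduct_add]

lemma seidel_quad {V : Type*} [Fintype V] (G : SimpleGraph V) [DecidableRel G.Adj] (v : V → ℝ) :
    v ⬝ᵥ (seidelOf G *ᵥ v) + 5 * (v ⬝ᵥ v) = (∑ i, v i)^2 + 4 * ∑ i, v i * v i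
      - 2 * ∑ i, ∑ j, if G.Adj i j then v i * v j else 0 := by
  classical
  have e : ∀ i j, v i * (seidelOf G i j * v j) = v i * v j - (if i = j then v i * v j else 0)
      - 2 * (if G.Adj i j then v i * v j else 0) := by
    intro i j
    unfold seidelOf
    by_cases h : i = j
    · subst h; simp
    · by_cases h' : G.Adj i j <;> simp [h, h'] <;> ring
  simp only [dotProduct, Matrix.mulVec, Finset.mul_sum, e, Finset.sum_sub_distrib, sq,
    Finset.sum_ite_eq, Finset.mem_univ, if_true]
  simp only [← Finset.mul_sum, ← Finset.sum_mul]
  ring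

lemma minSeidel_iff {V : Type*} [Fintype V] [Nonempty V] (G : SimpleGraph V) [DecidableRel G.Adj] :
    -5 ≤ minSeidelEig G ↔ ∀ v : V → ℝ, 0 ≤ (∑ i, v i)^2 + 4 * ∑ i, v i * v i
      - 2 * ∑ i, ∑ j, if G.Adj i j then v i * v j else 0 := by
  classical
  simp only [← seidel_quad]
  unfold minSeidelEig
  rw [Subsingleton.elim (Fintype.ofFinite V) ‹Fintype V›]
  convert minEig_iff (seidelOf G) ?_
  ext i j
  simp [seidelOf, eq_comm (a := j) (b := i), G.adj_comm j i]
  congr!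

open Classical in
lemma adj_sum (s₁ s₂ t : ℕ) (f : ((Unit ⊕ Unit) ⊕ ((Fin t × Fin 2) ⊕ (Fin s₁ ⊕ Fin s₂))) ⊕ (Fin 2 × Fin 2) → ℝ)
    (x y : ℝ) (a b : Fin t → ℝ) (c : Fin s₁ → ℝ) (d : Fin s₂ → ℝ) (p q : Fin 2 → ℝ)
    (hx : f (.inl (.inl (.inl ()))) = x) (hy : f (.inl (.inl (.inr ()))) = y)
    (ha : ∀ k, f (.inl (.inr (.inl (k, 0)))) = a k) (hb : ∀ k, f (.inl (.inr (.inl (k, 1)))) = b k)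
    (hc : ∀ k, f (.inl (.inr (.inr (.inl k)))) = c k) (hd : ∀ k, f (.inl (.inr (.inr (.inr k)))) = d k)
    (hp : ∀ k, f (.inr (k, 0)) = p k) (hq : ∀ k, f (.inr (k, 1)) = q k) :
    ((∑ i, f i)^2 + 4 * ∑ i, f i * f i
      - 2 * ∑ i, ∑ j, if (Mgraph s₁ s₂ t ⊕g nK2 2).Adj i j then f i * f j else 0) =
    (x + y + ∑ k, a k + ∑ k, b k + ∑ k, c k + ∑ k, d k + ∑ k, p k + ∑ k, q k)^2
    + 4 * (x^2 + y^2 - x * y + ∑ k, (c k ^2 - x * c k) + ∑ k, (d k ^2 - y * d k)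
      + ∑ k, (a k ^2 + b k ^2 - a k * b k - x * a k - y * b k) + ∑ k, (p k ^2 + q k ^2 - p k * q k)) := by
  simp only [Fintype.sum_sum_type, Fintype.sum_prod_type, hx, hy, ha, hb, hc, hd, hp, hq,
    Finset.univ_unique, Finset.sum_singleton, PUnit.default_eq_unit, Fin.sum_univ_two (M := ℝ), Finset.sum_add_distrib]
  simp [Mgraph, nK2, SimpleGraph.sum, hx, hy, ha, hb, hc, hd, hp, hq, Finset.sum_add_distrib]
  have e1 : ∑ k, b k * a k = ∑ k, a k * b k := by simp only [mul_comm]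
  simp only [Finset.sum_sub_distrib, Finset.sum_add_distrib, ← Finset.mul_sum, ← Finset.sum_mul, sq, e1]
  ring

lemma key_identity (s₁ s₂ t : ℕ) (x y u v : ℝ) (a b : Fin t → ℝ) (c : Fin s₁ → ℝ) (d : Fin s₂ → ℝ)
    (p q : Fin 2 → ℝ) (hx : x = u + v) (hy : y = u - v) :
    (x + y + ∑ k, a k + ∑ k, b k + ∑ k, c k + ∑ k, d k + ∑ k, p k + ∑ k, q k)^2
    + 4 * (x^2 + y^2 - x * y + ∑ k, (c k ^2 - x * c k) + ∑ k, (d k ^2 - y * d k)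
      + ∑ k, (a k ^2 + b k ^2 - a k * b k - x * a k - y * b k) + ∑ k, (p k ^2 + q k ^2 - p k * q k))
    = (x + y + ∑ k, a k + ∑ k, b k + ∑ k, c k + ∑ k, d k + ∑ k, p k + ∑ k, q k - 2 * u)^2
    + (36 - 3 * s₁ - 3 * s₂ - 4 * t) / 3 * v ^ 2
    + 4 * (∑ k, (c k - v / 2) ^ 2 + ∑ k, (d k + v / 2) ^ 2
      + ∑ k, ((a k - v / 3) ^ 2 + (b k + v / 3) ^ 2 - (a k - v / 3) * (b k + v / 3))
      + ∑ k, ((u + (p k + q k) / 2) ^ 2 + 3 / 4 * (p k - q k) ^ 2)) := by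
  subst hx hy
  have ec : ∑ k, (c k - v / 2) ^ 2 = ∑ k, c k ^ 2 - v * ∑ k, c k + s₁ * (v ^ 2 / 4) := by
    rw [Finset.mul_sum, ← Finset.sum_sub_distrib]
    have : (s₁ : ℝ) * (v ^ 2 / 4) = ∑ k : Fin s₁, v ^ 2 / 4 := by simp
    rw [this, ← Finset.sum_add_distrib]
    exact Finset.sum_congr rfl fun _ _ => by ring
  have ed : ∑ k, (d k + v / 2) ^ 2 = ∑ k, d k ^ 2 + v * ∑ k, d k + s₂ * (v ^ 2 / 4) := by
    rw [Finset.mul_sum, ← Finset.sum_add_distrib]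
    have : (s₂ : ℝ) * (v ^ 2 / 4) = ∑ k : Fin s₂, v ^ 2 / 4 := by simp
    rw [this, ← Finset.sum_add_distrib]
    exact Finset.sum_congr rfl fun _ _ => by ring
  have ea : ∑ k, ((a k - v / 3) ^ 2 + (b k + v / 3) ^ 2 - (a k - v / 3) * (b k + v / 3))
      = ∑ k, (a k ^ 2 + b k ^ 2 - a k * b k) - v * ∑ k, a k + v * ∑ k, b k + t * (v ^ 2 / 3) := by
    rw [Finset.mul_sum, Finset.mul_sum, ← Finset.sum_sub_distrib, ← Finset.sum_add_distrib]
    have : (t : ℝ) * (v ^ 2 / 3) = ∑ k : Fin t, v ^ 2 / 3 := by simp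
    rw [this, ← Finset.sum_add_distrib]
    exact Finset.sum_congr rfl fun _ _ => by ring
  rw [ec, ed, ea]
  simp only [Finset.sum_sub_distrib, Finset.sum_add_distrib, ← Finset.mul_sum, Fin.sum_univ_two (M := ℝ)]
  ring

/-- `λ_min(S(M(s₁,s₂,t) ∪ 2K₂)) ≥ -5` iff `3s₁ + 3s₂ + 4t ≤ 36`. -/
theorem stmt_19 (s₁ s₂ t : ℕ) :
    -5 ≤ minSeidelEig (Mgraph s₁ s₂ t ⊕g nK2 2) ↔ 3 * s₁ + 3 * s₂ + 4 * t ≤ 36 := by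
  classical
  rw [minSeidel_iff]
  constructor
  · intro h
    by_contra hK
    have hK' : (36 : ℝ) < 3 * s₁ + 3 * s₂ + 4 * t := by
      push Not at hK
      exact_mod_cast hK
    set δ : ℝ := s₁ - s₂ with hδ
    have h' := h (Sum.elim (Sum.elim (Sum.elim (fun _ => δ + 8) (fun _ => δ - 8))
      (Sum.elim (fun k => if k.2 = 0 then 8 / 3 else -8 / 3)
        (Sum.elim (fun _ => 4) (fun _ => -4)))) (fun _ => -δ))
    rw [adj_sum s₁ s₂ t _ (δ + 8) (δ - 8) (fun _ => 8 / 3) (fun _ => -8 / 3) (fun _ => 4)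
      (fun _ => -4) (fun _ => -δ) (fun _ => -δ) (by simp) (by simp) (by simp) (by simp) (by simp)
      (by simp) (by simp) (by simp),
      key_identity s₁ s₂ t _ _ δ 8 _ _ _ _ _ _ rfl rfl] at h'
    simp at h'
    have e : δ + δ + t * (8 / 3) + t * (-8 / 3) + s₁ * 4 + -(s₂ * 4 : ℝ)
      + -(2 * δ) + -(2 * δ) - 2 * δ = 0 := by rw [hδ]; ring
    rw [e] at h'
    norm_num at h'
    linarith
  · intro hK f
    have hK' : (0 : ℝ) ≤ 36 - 3 * s₁ - 3 * s₂ - 4 * t := by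
      have : (3 * s₁ + 3 * s₂ + 4 * t : ℝ) ≤ 36 := by exact_mod_cast hK
      linarith
    rw [adj_sum s₁ s₂ t f _ _ _ _ _ _ _ _ rfl rfl (fun _ => rfl) (fun _ => rfl) (fun _ => rfl)
      (fun _ => rfl) (fun _ => rfl) (fun _ => rfl)]
    generalize f (.inl (.inl (.inl ()))) = x
    generalize f (.inl (.inl (.inr ()))) = y
    rw [key_identity s₁ s₂ t x y ((x + y) / 2) ((x - y) / 2) _ _ _ _ _ _ (by ring) (by ring)]
    have hq : ∀ a b : ℝ, 0 ≤ a ^ 2 + b ^ 2 - a * b := fun a b => by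
      nlinarith [sq_nonneg (a - b), sq_nonneg a, sq_nonneg b]
    have h3 : ∀ g h : Fin t → ℝ, 0 ≤ ∑ k, (g k ^ 2 + h k ^ 2 - g k * h k) :=
      fun g h => Finset.sum_nonneg fun k _ => hq _ _
    have := h3 (fun k => f (.inl (.inr (.inl (k, 0)))) - (x - y) / 2 / 3)
      (fun k => f (.inl (.inr (.inl (k, 1)))) + (x - y) / 2 / 3)
    positivity
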